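/- Let G be a finite group of linear isometries of ℝ⁴ (a finite subgroup of the orthogonal group of EuclideanSpace ℝ (Fin 4)) which acts freely on the unit sphere S³, i.e. no non-identity element of G fixes a vector of norm one. If G contains a normal cyclic subgroup of index 3, then G is itself cyclic. -/

import Mathlib

open Module Module.End ComplexConjugate

/-- If a set of nonzero complex numbers with at most five elements is stable under inversion and
under the `r`-th power map, then the latter fixes every element `x` with `((x ^ r) ^ r) ^ r = x`. -/
theorem pow_eq_self_of_card_le_five {S : Finset ℂ} (hcard : S.card ≤ 5) {r : ℕ}
    (hinv : ∀ x ∈ S, x⁻¹ ∈ S) (hpow : ∀ x ∈ S, x ^ r ∈ S) (hne : ∀ x ∈ S, x ≠ 0)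
    {x : ℂ} (hx : x ∈ S) (hr : ((x ^ r) ^ r) ^ r = x) : x ^ r = x := by
  by_contra hxy
  have hy := hpow x hx
  have hz := hpow _ hy
  obtain ⟨y, hy'⟩ : ∃ y, y = x ^ r := ⟨_, rfl⟩
  obtain ⟨z, hz'⟩ : ∃ z, z = y ^ r := ⟨_, rfl⟩
  rw [← hy'] at hxy hy hz hr
  rw [← hz'] at hz hr
  have hyz : y ≠ z := fun h ↦ hxy (by grind)
  have hzx : z ≠ x := fun h ↦ hxy (by grind)
  have cycle : ∀ a b c : ℂ, a ^ r = b → b ^ r = c → c ^ r = a → a ≠ b → a ≠ 0 →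
      a ≠ a⁻¹ ∧ a ≠ b⁻¹ := by
    intro a b c hab hbc hca hne ha
    have self : a ≠ a⁻¹ := by
      intro h
      have h2 : a ^ 2 = 1 := by rw [sq]; nth_rewrite 2 [h]; exact mul_inv_cancel₀ ha
      have hb2 : b ^ 2 = 1 := by rw [← hab, ← pow_mul, mul_comm, pow_mul, h2, one_pow]
      rcases eq_or_eq_neg_of_sq_eq_sq b 1 (by rw [hb2, one_pow]) with hb1 | hb1
      · exact hne (by rw [← hca, ← hbc, hb1, one_pow, one_pow])
      · rcases eq_or_eq_neg_of_sq_eq_sq a 1 (by rw [h2, one_pow]) with h1 | h1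
        · exact hne (by rw [← hab, h1, one_pow])
        · rw [h1, hb1] at hne
          exact hne rfl
    refine ⟨self, fun h ↦ self ?_⟩
    have hb : b = a⁻¹ := by rw [h, inv_inv]
    have hc : c = a := by rw [← hbc, hb, inv_pow, hab, ← h]
    rw [← hb, ← hab, ← hc, hca, hc]
  have h1 := cycle x y z hy'.symm hz'.symm hr (Ne.symm hxy) (hne x hx)
  have h2 := cycle y z x hz'.symm hr hy'.symm hyz (hne y hy)
  have h3 := cycle z x y hr hy'.symm hz'.symm hzx (hne z hz)
  have hsub : ({x, y, z, x⁻¹, y⁻¹, z⁻¹} : Finset ℂ) ⊆ S := by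
    intro t ht
    simp only [Finset.mem_insert, Finset.mem_singleton] at ht
    rcases ht with rfl | rfl | rfl | rfl | rfl | rfl
    exacts [hx, hy, hz, hinv _ hx, hinv _ hy, hinv _ hz]
  have hle := Finset.card_le_card hsub
  have h6 : ({x, y, z, x⁻¹, y⁻¹, z⁻¹} : Finset ℂ).card = 6 := by
    have i1 : x⁻¹ ≠ y⁻¹ := fun h ↦ hxy (inv_injective h).symm
    have i2 : y⁻¹ ≠ z⁻¹ := fun h ↦ hyz (inv_injective h)
    have i3 : z⁻¹ ≠ x⁻¹ := fun h ↦ hzx (inv_injective h)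
    have i4 : x ≠ z⁻¹ := fun h ↦ h3.2 (by rw [h, inv_inv])
    have i5 : y ≠ x⁻¹ := fun h ↦ h1.2 (by rw [h, inv_inv])
    have i6 : z ≠ y⁻¹ := fun h ↦ h2.2 (by rw [h, inv_inv])
    obtain ⟨a1, a2⟩ := h1
    obtain ⟨b1, b2⟩ := h2
    obtain ⟨c1, c2⟩ := h3
    rw [Finset.card_insert_of_notMem, Finset.card_insert_of_notMem, Finset.card_insert_of_notMem,
      Finset.card_insert_of_notMem, Finset.card_insert_of_notMem, Finset.card_singleton] <;>
    simp only [Finset.mem_insert, Finset.mem_singleton, not_or] <;> grind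
  omega

section

variable {G V : Type*} [Group G] [AddCommGroup V] [Module ℂ V]

theorem Representation.pow_apply_of_apply_eq_smul (ρ : Representation ℂ G V) {g : G} {v : V}
    {μ : ℂ} (h : ρ g v = μ • v) (n : ℕ) : ρ (g ^ n) v = μ ^ n • v := by
  induction n with
  | zero => simp
  | succ n ih => rw [pow_succ, map_mul, Module.End.mul_apply, h, map_smul, ih, smul_smul, pow_succ']

/-- In a representation without nonzero fixed vectors, two elements acting on a nonzero vector by
the same scalar are equal. -/
theorem Representation.eq_of_apply_eq (ρ : Representation ℂ G V)
    (hfree : ∀ g v, ρ g v = v → v ≠ 0 → g = 1) {g k : G} {v : V} (hv : v ≠ 0)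
    (h : ρ g v = ρ k v) : g = k := by
  have h1 : ρ (k⁻¹ * g) v = v := by
    rw [map_mul, Module.End.mul_apply, h, ← Module.End.mul_apply, ← map_mul, inv_mul_cancel,
      map_one, Module.End.one_apply]
  exact (inv_mul_eq_one.mp (hfree _ v h1 hv)).symm

/-- A finite group acting freely and generated by two commuting elements is cyclic. -/
theorem Representation.isCyclic_of_commute [Finite G] [FiniteDimensional ℂ V] [Nontrivial V]
    (ρ : Representation ℂ G V)
    (hfree : ∀ g v, ρ g v = v → v ≠ 0 → g = 1) {g h : G} (hcomm : Commute g h)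
    (hgen : Subgroup.closure {g, h} = ⊤) : IsCyclic G := by
  obtain ⟨μ, hμ⟩ := Module.End.exists_eigenvalue (ρ h)
  have hmaps : Set.MapsTo (ρ g) (eigenspace (ρ h) μ) (eigenspace (ρ h) μ) :=
    Module.End.mapsTo_genEigenspace_of_comm (hcomm.symm.map ρ) μ 1
  have : Nontrivial (eigenspace (ρ h) μ) := (Submodule.nontrivial_iff_ne_bot).mpr hμ
  obtain ⟨ν, hν⟩ := Module.End.exists_eigenvalue ((ρ g).restrict hmaps)
  obtain ⟨w, hw⟩ := hν.exists_hasEigenvector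
  obtain ⟨v, hv⟩ := w
  have hv0 : v ≠ 0 := fun h0 ↦ hw.2 (by ext; exact h0)
  have hgv : ρ g v = ν • v := congrArg Subtype.val hw.apply_eq_smul
  have hhv : ρ h v = μ • v := mem_eigenspace_iff.mp hv
  have hall : ∀ k : G, ∃ c : ℂ, ρ k v = c • v := by
    intro k
    have hk : k ∈ Subgroup.closure {g, h} := hgen ▸ Subgroup.mem_top k
    induction hk using Subgroup.closure_induction with
    | mem x hx => rcases hx with rfl | rfl; exacts [⟨_, hgv⟩, ⟨_, hhv⟩]
    | one => exact ⟨1, by simp⟩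
    | mul x y _ _ hx hy =>
      obtain ⟨a, ha⟩ := hx
      obtain ⟨b, hb⟩ := hy
      exact ⟨b * a, by rw [map_mul, Module.End.mul_apply, hb, map_smul, ha, smul_smul]⟩
    | inv x _ hx =>
      obtain ⟨a, ha⟩ := hx
      have h1 : v = a • ρ x⁻¹ v := by
        rw [← map_smul, ← ha, ← Module.End.mul_apply, ← map_mul]; simp
      have ha0 : a ≠ 0 := fun h0 ↦ hv0 (by rw [h1, h0, zero_smul])
      exact ⟨a⁻¹, by nth_rewrite 2 [h1]; rw [smul_smul, inv_mul_cancel₀ ha0, one_smul]⟩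
  choose c hc using hall
  let χ : G →* ℂ :=
    { toFun := c
      map_one' := smul_left_injective ℂ hv0 (by simp [← hc])
      map_mul' := fun x y ↦ smul_left_injective ℂ hv0 (by
        change c (x * y) • v = (c x * c y) • v
        rw [← hc, map_mul, Module.End.mul_apply, hc y, map_smul, hc x, smul_smul, mul_comm]) }
  refine isCyclic_of_injective_ringHom χ fun x y hxy ↦ ρ.eq_of_apply_eq hfree hv0 ?_
  rw [hc, hc]
  exact congrArg (· • v) hxy

theorem Representation.commute_of_conj_mem_zpowers [Finite G] [FiniteDimensional ℂ V]
    [Nontrivial V] (ρ : Representation ℂ G V) (hdim : finrank ℂ V ≤ 5)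
    (hfree : ∀ g v, ρ g v = v → v ≠ 0 → g = 1)
    (hconj : ∀ g μ, HasEigenvalue (ρ g) μ → HasEigenvalue (ρ g) (conj μ))
    {g h : G} (hgh : g⁻¹ * h * g ∈ Subgroup.zpowers h) (hg3 : Commute (g ^ 3) h) :
    Commute g h := by
  rw [← mem_powers_iff_mem_zpowers] at hgh
  obtain ⟨r, hr⟩ := hgh
  simp only at hr
  have hswap : h * g = g * h ^ r := by rw [hr]; group
  obtain ⟨x, hx⟩ := Module.End.exists_eigenvalue (ρ h)
  obtain ⟨v, hv⟩ := hx.exists_hasEigenvector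
  have hpow1 : ∀ μ, HasEigenvalue (ρ h) μ → μ ^ orderOf h = 1 := by
    intro μ hμ
    obtain ⟨w, hw⟩ := hμ.exists_hasEigenvector
    have h1 := ρ.pow_apply_of_apply_eq_smul hw.apply_eq_smul (orderOf h)
    refine smul_left_injective ℂ hw.2 ?_
    simpa [pow_orderOf_eq_one] using h1.symm
  have hxr : x ^ r = x := by
    have hmem : ∀ μ, μ ∈ (ρ h).charpoly.roots.toFinset ↔ HasEigenvalue (ρ h) μ := by
      intro μ
      rw [Multiset.mem_toFinset, Polynomial.mem_roots (LinearMap.charpoly_monic _).ne_zero,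
        Module.End.hasEigenvalue_iff_isRoot_charpoly]
    have hpos : orderOf h ≠ 0 := (orderOf_pos h).ne'
    refine pow_eq_self_of_card_le_five (S := (ρ h).charpoly.roots.toFinset) ?_ ?_ ?_ ?_
      ((hmem x).mpr hx) ?_
    · calc _ ≤ _ := Multiset.toFinset_card_le _
        _ ≤ _ := Polynomial.card_roots' _
        _ ≤ 5 := by rwa [LinearMap.charpoly_natDegree]
    · intro μ hμ
      rw [hmem] at hμ ⊢
      rw [Complex.inv_eq_conj (Complex.norm_eq_one_of_pow_eq_one (hpow1 μ hμ) hpos)]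
      exact hconj h μ hμ
    · intro μ hμ
      rw [hmem] at hμ ⊢
      obtain ⟨w, hw⟩ := hμ.exists_hasEigenvector
      refine hasEigenvalue_of_hasEigenvector (x := ρ g w) ⟨?_, ?_⟩
      · rw [mem_eigenspace_iff, ← Module.End.mul_apply, ← map_mul, hswap, map_mul,
          Module.End.mul_apply, ρ.pow_apply_of_apply_eq_smul hw.apply_eq_smul, map_smul]
      · intro h0
        apply hw.2
        have : ρ (g⁻¹ * g) w = ρ g⁻¹ (ρ g w) := by rw [map_mul, Module.End.mul_apply]
        simpa [h0] using this
    · rintro μ hμ rfl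
      simpa [hpos] using hpow1 0 ((hmem 0).mp hμ)
    · have hpow : ∀ (a : G) (n : ℕ), (g⁻¹ * a * g) ^ n = g⁻¹ * a ^ n * g := by
        intro a n
        simpa using conj_pow (a := g⁻¹) (b := a) (i := n)
      have h3 : ((h ^ r) ^ r) ^ r = h := by
        rw [hr, hpow, hr, hpow, hpow, hr]
        have := hg3.eq
        calc _ = (g ^ 3)⁻¹ * (h * g ^ 3) := by
              simp only [pow_succ, pow_zero, one_mul, mul_inv_rev, mul_assoc]
          _ = h := by rw [← this]; group
      have := ρ.pow_apply_of_apply_eq_smul (ρ.pow_apply_of_apply_eq_smul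
        (ρ.pow_apply_of_apply_eq_smul hv.apply_eq_smul r) r) r
      rw [h3, hv.apply_eq_smul] at this
      exact smul_left_injective ℂ hv.2 this.symm
  have : h ^ r = h := ρ.eq_of_apply_eq hfree hv.2 (by
    rw [ρ.pow_apply_of_apply_eq_smul hv.apply_eq_smul, hxr, hv.apply_eq_smul])
  rw [this] at hswap
  exact hswap.symm

theorem Representation.isCyclic_of_index_eq_three [Finite G] [FiniteDimensional ℂ V]
    [Nontrivial V] (ρ : Representation ℂ G V) (hdim : finrank ℂ V ≤ 5)
    (hfree : ∀ g v, ρ g v = v → v ≠ 0 → g = 1)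
    (hconj : ∀ g μ, HasEigenvalue (ρ g) μ → HasEigenvalue (ρ g) (conj μ))
    (H : Subgroup G) [hnormal : H.Normal] [IsCyclic H] (hindex : H.index = 3) : IsCyclic G := by
  obtain ⟨h, rfl⟩ := (Subgroup.isCyclic_iff_exists_zpowers_eq_top H).mp inferInstance
  have hh := Subgroup.mem_zpowers h
  obtain ⟨g, hg⟩ : ∃ g, g ∉ Subgroup.zpowers h := by
    by_contra! hall
    have : Subgroup.zpowers h = ⊤ := (Subgroup.eq_top_iff' _).mpr hall
    rw [this, Subgroup.index_top] at hindex
    omega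
  have hg3 : g ^ 3 ∈ Subgroup.zpowers h := hindex ▸ Subgroup.pow_index_mem _ g
  have hcomm : Commute g h := by
    refine ρ.commute_of_conj_mem_zpowers hdim hfree hconj ?_ ?_
    · simpa using hnormal.conj_mem h hh g⁻¹
    · obtain ⟨n, hn⟩ := hg3
      simp only at hn
      rw [← hn]
      exact (Commute.refl h).zpow_left n
  refine ρ.isCyclic_of_commute hfree hcomm ?_
  set K := Subgroup.closure {g, h}
  have hgK : g ∈ K := Subgroup.subset_closure (by simp)
  have hle : Subgroup.zpowers h ≤ K :=
    (Subgroup.zpowers_le).mpr (Subgroup.subset_closure (by simp))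
  have hdvd := Subgroup.relIndex_mul_index hle
  rw [hindex] at hdvd
  rcases (Nat.dvd_prime Nat.prime_three).mp (Dvd.intro_left _ hdvd) with h1 | h1
  · exact Subgroup.index_eq_one.mp h1
  · have : (Subgroup.zpowers h).relIndex K = 1 := by rw [h1] at hdvd; omega
    exact absurd (Subgroup.relIndex_eq_one.mp this hgK) hg

end

/-- The vector of real parts of a complex vector. -/
noncomputable def euclideanRe {n : ℕ} (v : Fin n → ℂ) : EuclideanSpace ℝ (Fin n) :=
  WithLp.toLp 2 fun i ↦ (v i).re

/-- The vector of imaginary parts of a complex vector. -/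
noncomputable def euclideanIm {n : ℕ} (v : Fin n → ℂ) : EuclideanSpace ℝ (Fin n) :=
  WithLp.toLp 2 fun i ↦ (v i).im

section

variable {n : ℕ} (u v : Fin n → ℂ) (c : ℂ)

theorem euclideanRe_add : euclideanRe (u + v) = euclideanRe u + euclideanRe v := rfl

theorem euclideanIm_add : euclideanIm (u + v) = euclideanIm u + euclideanIm v := rfl

theorem euclideanRe_smul :
    euclideanRe (c • v) = c.re • euclideanRe v - c.im • euclideanIm v := by
  ext i
  simp [euclideanRe, euclideanIm]

theorem euclideanIm_smul :
    euclideanIm (c • v) = c.re • euclideanIm v + c.im • euclideanRe v := by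
  ext i
  simp [euclideanRe, euclideanIm]

end

/-- The complexification of the action of linear isometries of `ℝⁿ`. -/
noncomputable def complexifiedIsometryRepresentation (n : ℕ) :
    Representation ℂ (EuclideanSpace ℝ (Fin n) ≃ₗᵢ[ℝ] EuclideanSpace ℝ (Fin n)) (Fin n → ℂ) where
  toFun g :=
    { toFun := fun v i ↦ ⟨g (euclideanRe v) i, g (euclideanIm v) i⟩
      map_add' := fun u v ↦ by
        ext i
        apply Complex.ext <;> simp [euclideanRe_add, euclideanIm_add]
      map_smul' := fun c v ↦ by
        ext i
        apply Complex.ext <;> simp [euclideanRe_smul, euclideanIm_smul] }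
  map_one' := rfl
  map_mul' _ _ := rfl

section

variable {n : ℕ} (g : EuclideanSpace ℝ (Fin n) ≃ₗᵢ[ℝ] EuclideanSpace ℝ (Fin n))

theorem euclideanRe_complexifiedIsometryRepresentation (v : Fin n → ℂ) :
    euclideanRe (complexifiedIsometryRepresentation n g v) = g (euclideanRe v) := rfl

theorem euclideanIm_complexifiedIsometryRepresentation (v : Fin n → ℂ) :
    euclideanIm (complexifiedIsometryRepresentation n g v) = g (euclideanIm v) := rfl

theorem exists_apply_eq_self_of_complexified_apply_eq_self {v : Fin n → ℂ} (hv : v ≠ 0)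
    (h : complexifiedIsometryRepresentation n g v = v) : ∃ w, ‖w‖ = 1 ∧ g w = w := by
  obtain ⟨w, hw0, hw⟩ : ∃ w, w ≠ 0 ∧ g w = w := by
    by_cases hre : euclideanRe v = 0
    · refine ⟨euclideanIm v, fun him ↦ hv ?_, ?_⟩
      · ext i
        exact Complex.ext (congrArg (· i) hre) (congrArg (· i) him)
      · rw [← euclideanIm_complexifiedIsometryRepresentation, h]
    · exact ⟨euclideanRe v, hre, by rw [← euclideanRe_complexifiedIsometryRepresentation, h]⟩
  exact ⟨‖w‖⁻¹ • w, norm_smul_inv_norm (𝕜 := ℝ) hw0, by rw [map_smul, hw]⟩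

theorem complexifiedIsometryRepresentation_star (v : Fin n → ℂ) :
    complexifiedIsometryRepresentation n g (star v) =
      star (complexifiedIsometryRepresentation n g v) := by
  have him : euclideanIm (star v) = -euclideanIm v := rfl
  ext i
  apply Complex.ext
  · rfl
  · change g (euclideanIm (star v)) i = -(g (euclideanIm v) i)
    rw [him, map_neg]
    rfl

theorem hasEigenvalue_conj_complexifiedIsometryRepresentation {μ : ℂ}
    (hμ : HasEigenvalue (complexifiedIsometryRepresentation n g) μ) :
    HasEigenvalue (complexifiedIsometryRepresentation n g) (conj μ) := by
  obtain ⟨v, hv⟩ := hμ.exists_hasEigenvector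
  refine hasEigenvalue_of_hasEigenvector (x := star v) ⟨?_, fun h ↦ hv.2 (star_eq_zero.mp h)⟩
  rw [mem_eigenspace_iff, complexifiedIsometryRepresentation_star, hv.apply_eq_smul, star_smul]
  rfl

end

/-- If a finite group `G` of linear isometries of `ℝ⁴` acts freely on the unit sphere
`S³` (no non-identity element fixes a vector of norm one) and `G` contains a normal
cyclic subgroup of index 3, then `G` is cyclic. -/
theorem cyclic_of_free_sphere_action_of_index_three_normal_cyclic_subgroup
    (G : Subgroup (EuclideanSpace ℝ (Fin 4) ≃ₗᵢ[ℝ] EuclideanSpace ℝ (Fin 4)))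
    [Finite G]
    (hfree : ∀ g ∈ G, g ≠ 1 → ∀ v : EuclideanSpace ℝ (Fin 4), ‖v‖ = 1 → g v ≠ v)
    (H : Subgroup G) (hnormal : H.Normal) (hcyclic : IsCyclic H)
    (hindex : H.index = 3) :
    IsCyclic G := by
  refine Representation.isCyclic_of_index_eq_three
    ((complexifiedIsometryRepresentation 4).comp G.subtype) (by simp) (fun g v hgv hv ↦ ?_)
    (fun g μ hμ ↦ hasEigenvalue_conj_complexifiedIsometryRepresentation g.1 hμ) H hindex
  by_contra hg
  obtain ⟨w, hw1, hw⟩ := exists_apply_eq_self_of_complexified_apply_eq_self g.1 hv hgv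
  exact hfree g g.2 (fun h ↦ hg (Subtype.ext h)) w hw1 hw
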